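/- arXiv:2002.04006 — 9 statements merged into one kernel-verified Lean document; each statement's English description precedes it below -/
import Mathlib

section
/- Fix an integer k ≥ 1 and a symmetric configuration on [−1,1] with dual points G₁,…,G_k and interpolation nodes D₀,…,D_k, and let r ≥ 0 be an integer. Then the configuration satisfies the k-r-order orthogonal condition if and only if Σ_{j=1}^{k} (D_j − D_{j−1})·G_j^{i+1} = 2/(i+2) for every odd integer i with 1 ≤ i ≤ r. -/
open Polynomial

/-- The step interpolation: `(Πw)(x) = w (D m)` for `x ∈ (G m, G (m+1)]`. -/
noncomputable def stepInterp (k : ℕ) (G D : ℕ → ℝ) (w : ℝ → ℝ) (x : ℝ) : ℝ :=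
  ∑ m ∈ Finset.range (k + 1), if x ∈ Set.Ioc (G m) (G (m + 1)) then w (D m) else 0

/-- A symmetric configuration of dual points `G 1 < … < G k` (with `G 0 = -1`,
`G (k+1) = 1`) and interpolation nodes `D 0 = -1 < D 1 < … < D k = 1` on `[-1,1]`. -/
structure SymmConfig (k : ℕ) where
  G : ℕ → ℝ
  D : ℕ → ℝ
  G_zero : G 0 = -1
  G_last : G (k + 1) = 1
  G_mono : ∀ j ≤ k, G j < G (j + 1)
  G_symm : ∀ j, 1 ≤ j → j ≤ k → G j = -G (k + 1 - j)
  D_zero : D 0 = -1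
  D_last : D k = 1
  D_mono : ∀ j < k, D j < D (j + 1)
  D_symm : ∀ j ≤ k, D j = -D (k - j)

/-- The `k`-`r`-order orthogonal condition. -/
def OrthCond (k r : ℕ) (c : SymmConfig k) : Prop :=
  ∀ g w : Polynomial ℝ, g.degree ≤ (r : ℕ) → w.degree ≤ 1 →
    ∫ x in (-1:ℝ)..1,
      g.eval x * (w.eval x - stepInterp k c.G c.D (fun t => w.eval t) x) = 0

namespace SymmConfig

variable {k : ℕ} (c : SymmConfig k)

/-- The `n`-th moment `Σ_{j=1}^{k} (D j − D (j−1)) (G j)^n` of the dual quadrature rule. -/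
noncomputable def dualMoment (n : ℕ) : ℝ :=
  ∑ j ∈ Finset.Icc 1 k, (c.D j - c.D (j - 1)) * (c.G j) ^ n

theorem G_le_G {i j : ℕ} (hij : i ≤ j) (hj : j ≤ k + 1) : c.G i ≤ c.G j := by
  induction j, hij using Nat.le_induction with
  | base => exact le_rfl
  | succ j _ ih => exact (ih (by omega)).trans (c.G_mono j (by omega)).le

theorem Ioc_G_subset {m : ℕ} (hm : m ≤ k) :
    Set.Ioc (c.G m) (c.G (m + 1)) ⊆ Set.Ioc (-1) 1 := by
  apply Set.Ioc_subset_Ioc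
  · rw [← c.G_zero]; exact c.G_le_G (Nat.zero_le m) (by omega)
  · rw [← c.G_last]; exact c.G_le_G (by omega) le_rfl

theorem intervalIntegrable_mul_ite {f : ℝ → ℝ} (hf : Continuous f) (a b u v y : ℝ) :
    IntervalIntegrable (fun x => f x * if x ∈ Set.Ioc u v then y else 0)
      MeasureTheory.volume a b := by
  have h : (fun x => f x * if x ∈ Set.Ioc u v then y else 0)
      = (Set.Ioc u v).indicator fun x => f x * y := by
    ext x
    simp [Set.indicator_apply]
  have hi := (hf.mul continuous_const : Continuous fun x => f x * y).intervalIntegrable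
    (μ := MeasureTheory.volume) a b
  rw [h]
  exact ⟨hi.1.indicator measurableSet_Ioc, hi.2.indicator measurableSet_Ioc⟩

theorem integral_mul_ite {f : ℝ → ℝ} {m : ℕ} (hm : m ≤ k) (y : ℝ) :
    ∫ x in (-1:ℝ)..1, f x * (if x ∈ Set.Ioc (c.G m) (c.G (m + 1)) then y else 0)
      = ∫ x in c.G m..c.G (m + 1), f x * y := by
  have h : (fun x => f x * if x ∈ Set.Ioc (c.G m) (c.G (m + 1)) then y else 0)
      = (Set.Ioc (c.G m) (c.G (m + 1))).indicator fun x => f x * y := by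
    ext x
    simp [Set.indicator_apply]
  rw [h, intervalIntegral.integral_of_le (by norm_num),
    intervalIntegral.integral_of_le (c.G_mono m hm).le,
    MeasureTheory.setIntegral_indicator measurableSet_Ioc,
    Set.inter_eq_right.mpr (c.Ioc_G_subset hm)]

theorem integral_mul_sub_stepInterp {f w : ℝ → ℝ} (hf : Continuous f) (hw : Continuous w) :
    ∫ x in (-1:ℝ)..1, f x * (w x - stepInterp k c.G c.D w x)
      = ∑ m ∈ Finset.range (k + 1),
          ∫ x in c.G m..c.G (m + 1), f x * (w x - w (c.D m)) := by
  have hfw : Continuous fun x => f x * w x := hf.mul hw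
  have hfc (m : ℕ) : Continuous fun x => f x * w (c.D m) := hf.mul continuous_const
  have hstep : IntervalIntegrable (fun x => ∑ m ∈ Finset.range (k + 1),
      f x * if x ∈ Set.Ioc (c.G m) (c.G (m + 1)) then w (c.D m) else 0)
      MeasureTheory.volume (-1) 1 := by
    simpa only [Finset.sum_fn] using IntervalIntegrable.sum (Finset.range (k + 1))
      fun m _ => intervalIntegrable_mul_ite hf (-1) 1 (c.G m) (c.G (m + 1)) (w (c.D m))
  simp only [mul_sub, stepInterp, Finset.mul_sum]
  rw [intervalIntegral.integral_sub (hfw.intervalIntegrable _ _) hstep,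
    intervalIntegral.integral_finsetSum fun m _ => intervalIntegrable_mul_ite hf _ _ _ _ _,
    ← c.G_zero, ← c.G_last, ← intervalIntegral.sum_integral_adjacent_intervals
      fun m _ => hfw.intervalIntegrable _ _,
    ← Finset.sum_sub_distrib, c.G_zero, c.G_last]
  refine Finset.sum_congr rfl fun m hm => ?_
  rw [c.integral_mul_ite (Nat.lt_succ_iff.mp (Finset.mem_range.mp hm)),
    intervalIntegral.integral_sub (hfw.intervalIntegrable _ _)
      ((hfc m).intervalIntegrable _ _)]

/-- Summation by parts for the interpolation nodes and dual points. -/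
theorem sum_D_mul_sub (n : ℕ) :
    ∑ m ∈ Finset.range (k + 1), c.D m * (c.G (m + 1) ^ n - c.G m ^ n)
      = 1 + (-1) ^ n - c.dualMoment n := by
  have key : ∀ l : ℕ, ∑ m ∈ Finset.range (l + 1), c.D m * (c.G (m + 1) ^ n - c.G m ^ n)
      = c.D l * c.G (l + 1) ^ n - c.D 0 * c.G 0 ^ n
        - ∑ j ∈ Finset.Icc 1 l, (c.D j - c.D (j - 1)) * c.G j ^ n := by
    intro l
    induction l with
    | zero => simp [mul_sub]
    | succ l ih =>
      rw [Finset.sum_range_succ, ih, Finset.sum_Icc_succ_top (by omega), Nat.add_sub_cancel]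
      ring
  rw [key, c.D_last, c.G_last, c.D_zero, c.G_zero, dualMoment]
  ring

theorem dualMoment_eq_zero {n : ℕ} (hn : Odd n) : c.dualMoment n = 0 := by
  have h : c.dualMoment n = -c.dualMoment n := by
    conv_lhs => rw [dualMoment]
    rw [dualMoment, ← Finset.sum_neg_distrib]
    refine Finset.sum_nbij' (fun j => k + 1 - j) (fun j => k + 1 - j) ?_ ?_ ?_ ?_ ?_
    · intro j hj; simp only [Finset.mem_Icc] at hj ⊢; omega
    · intro j hj; simp only [Finset.mem_Icc] at hj ⊢; omega
    · intro j hj; simp only [Finset.mem_Icc] at hj; omega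
    · intro j hj; simp only [Finset.mem_Icc] at hj; omega
    · intro j hj
      obtain ⟨h1, h2⟩ := Finset.mem_Icc.mp hj
      rw [c.G_symm j h1 h2, c.D_symm j h2, c.D_symm (j - 1) (by omega), hn.neg_pow,
        show k + 1 - j - 1 = k - j by omega, show k - (j - 1) = k + 1 - j by omega]
      ring
  linarith

/-- The `n`-th moment of the interpolation error `x - Π x`. -/
noncomputable def errorMoment (n : ℕ) : ℝ :=
  ∑ m ∈ Finset.range (k + 1), ∫ x in c.G m..c.G (m + 1), x ^ n * (x - c.D m)

theorem errorMoment_eq (n : ℕ) :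
    c.errorMoment n = (1 - (-1) ^ (n + 2)) / (n + 2)
      - (1 + (-1) ^ (n + 1) - c.dualMoment (n + 1)) / (n + 1) := by
  have h : ∀ m, ∫ x in c.G m..c.G (m + 1), x ^ n * (x - c.D m)
      = (c.G (m + 1) ^ (n + 2) - c.G m ^ (n + 2)) / (n + 2)
        - c.D m * (c.G (m + 1) ^ (n + 1) - c.G m ^ (n + 1)) / (n + 1) := by
    intro m
    simp only [mul_sub, ← pow_succ]
    rw [intervalIntegral.integral_sub (by simp) (by simp), intervalIntegral.integral_mul_const,
      integral_pow, integral_pow]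
    push_cast
    ring
  simp only [errorMoment, h]
  rw [Finset.sum_sub_distrib, ← Finset.sum_div, ← Finset.sum_div, c.sum_D_mul_sub,
    Finset.sum_range_sub (fun m => c.G m ^ (n + 2)), c.G_zero, c.G_last, one_pow]

theorem errorMoment_eq_zero_of_even {n : ℕ} (hn : Even n) : c.errorMoment n = 0 := by
  rw [errorMoment_eq, c.dualMoment_eq_zero hn.add_one, hn.add_one.neg_one_pow,
    (hn.add even_two).neg_one_pow]
  simp

theorem errorMoment_eq_zero_iff {n : ℕ} (hn : Odd n) :
    c.errorMoment n = 0 ↔ c.dualMoment (n + 1) = 2 / ((n : ℝ) + 2) := by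
  rw [errorMoment_eq, hn.add_one.neg_one_pow, (hn.add_even even_two).neg_one_pow]
  have h1 : (n : ℝ) + 1 ≠ 0 := by positivity
  have h2 : (n : ℝ) + 2 ≠ 0 := by positivity
  field_simp
  constructor <;> intro h <;> linarith

theorem integral_eval_mul_sub_stepInterp (g w : ℝ[X]) (hw : w.degree ≤ 1) :
    ∫ x in (-1:ℝ)..1,
      g.eval x * (w.eval x - stepInterp k c.G c.D (fun t => w.eval t) x)
      = w.coeff 1 * ∑ n ∈ Finset.range (g.natDegree + 1), g.coeff n * c.errorMoment n := by
  rw [c.integral_mul_sub_stepInterp g.continuous w.continuous]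
  have hw' : ∀ x, w.eval x = w.coeff 1 * x + w.coeff 0 := fun x => by
    conv_lhs => rw [eq_X_add_C_of_degree_le_one hw]
    simp
  have h : ∀ m, ∫ x in c.G m..c.G (m + 1), g.eval x * (w.eval x - w.eval (c.D m))
      = ∑ n ∈ Finset.range (g.natDegree + 1),
          w.coeff 1 * (g.coeff n * ∫ x in c.G m..c.G (m + 1), x ^ n * (x - c.D m)) := by
    intro m
    simp only [← intervalIntegral.integral_const_mul]
    rw [← intervalIntegral.integral_finsetSum
      fun n _ => Continuous.intervalIntegrable (by fun_prop) _ _]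
    refine intervalIntegral.integral_congr fun x _ => ?_
    simp only [hw', eval_eq_sum_range, Finset.sum_mul]
    exact Finset.sum_congr rfl fun n _ => by ring
  simp only [h, errorMoment, Finset.mul_sum]
  exact Finset.sum_comm

theorem orthCond_iff_errorMoment (r : ℕ) :
    OrthCond k r c ↔ ∀ n ≤ r, c.errorMoment n = 0 := by
  constructor
  · intro h n hn
    have hX := h (X ^ n) X (by rw [degree_X_pow]; exact_mod_cast hn) degree_X_le
    rw [c.integral_eval_mul_sub_stepInterp _ _ degree_X_le] at hX
    simpa [coeff_X_pow] using hX
  · intro h g w hg hw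
    rw [c.integral_eval_mul_sub_stepInterp g w hw, Finset.sum_eq_zero, mul_zero]
    intro n hn
    have := natDegree_le_of_degree_le hg
    rw [h n (by rw [Finset.mem_range] at hn; omega), mul_zero]

end SymmConfig

/-- the `k`-`r`-order orthogonal condition holds iff
`Σ_{j=1}^{k} (D j − D (j−1)) (G j)^{i+1} = 2/(i+2)` for every odd `1 ≤ i ≤ r`. -/
theorem orthCond_iff_sum (k : ℕ) (hk : 1 ≤ k) (c : SymmConfig k) (r : ℕ) :
    OrthCond k r c ↔
      ∀ i : ℕ, Odd i → 1 ≤ i → i ≤ r →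
        ∑ j ∈ Finset.Icc 1 k, (c.D j - c.D (j - 1)) * (c.G j) ^ (i + 1)
          = 2 / ((i : ℝ) + 2) := by
  rw [c.orthCond_iff_errorMoment]
  constructor
  · intro h i hi _ hir
    exact (c.errorMoment_eq_zero_iff hi).mp (h i hir)
  · intro h n hn
    rcases n.even_or_odd with he | ho
    · exact c.errorMoment_eq_zero_of_even he
    · exact (c.errorMoment_eq_zero_iff ho).mpr (h n ho ho.pos hn)
end

section
/- Let k = 2l−1 with integer l ≥ 2, and let 1 > α₁ > … > α_{l−1} > 0 and 1 > a₁ > … > a_{l−1} > 0 be given parameters with associated symmetric configuration. For any integer r ≥ 1, the configuration satisfies the k-r-order orthogonal condition if and only if, for every odd integer i with 1 ≤ i ≤ r, (1 − α₁^{i+1}) + Σ_{j=1}^{l−2} a_j·(α_j^{i+1} − α_{j+1}^{i+1}) + a_{l−1}·α_{l−1}^{i+1} = (i+1)/(i+2). -/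
open Polynomial

namespace SymmConfig

open intervalIntegral MeasureTheory

variable {k : ℕ} (c : SymmConfig k)

lemma neg_one_le_G {m : ℕ} (hm : m ≤ k + 1) : -1 ≤ c.G m := by
  induction m with
  | zero => exact c.G_zero.ge
  | succ m ih => linarith [ih (by omega), c.G_mono m (by omega)]

lemma G_le_one {m : ℕ} (hm : m ≤ k + 1) : c.G m ≤ 1 := by
  induction hm using Nat.decreasingInduction with
  | self => exact c.G_last.le
  | of_succ m hm ih => linarith [c.G_mono m (by omega)]

/-- The symmetry of the dual points, including the two endpoints. -/
lemma G_reflect {m : ℕ} (hm : m ≤ k + 1) : c.G (k + 1 - m) = -c.G m := by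
  rcases Nat.eq_zero_or_pos m with rfl | hpos
  · simp [c.G_zero, c.G_last]
  rcases hm.eq_or_lt with rfl | hlt
  · simp [c.G_zero, c.G_last]
  · linarith [c.G_symm m hpos (by omega)]

lemma intervalIntegrable_mul_piece {g : ℝ → ℝ} (hg : Continuous g) (u v y : ℝ) :
    IntervalIntegrable (fun x => g x * if x ∈ Set.Ioc u v then y else 0) volume (-1) 1 := by
  have h : (fun x => g x * if x ∈ Set.Ioc u v then y else 0)
      = (Set.Ioc u v).indicator fun x => g x * y := by
    ext x
    simp [Set.indicator_apply]
  rw [h, intervalIntegrable_iff]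
  exact (intervalIntegrable_iff.1 ((hg.mul continuous_const).intervalIntegrable _ _)).indicator
    measurableSet_Ioc

lemma integral_mul_piece (g : ℝ → ℝ) {u v : ℝ} (hu : -1 ≤ u) (huv : u ≤ v) (hv : v ≤ 1) (y : ℝ) :
    ∫ x in (-1:ℝ)..1, g x * (if x ∈ Set.Ioc u v then y else 0) = y * ∫ x in u..v, g x := by
  have h : (fun x => g x * if x ∈ Set.Ioc u v then y else 0)
      = (Set.Ioc u v).indicator fun x => y * g x := by
    ext x
    simp [Set.indicator_apply, mul_comm]
  rw [h, integral_of_le (by norm_num), setIntegral_indicator measurableSet_Ioc,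
    Set.inter_eq_right.2 (Set.Ioc_subset_Ioc hu hv), ← integral_of_le huv,
    intervalIntegral.integral_const_mul]

lemma mul_stepInterp (g w : ℝ → ℝ) :
    (fun x => g x * stepInterp k c.G c.D w x) = fun x => ∑ m ∈ Finset.range (k + 1),
      g x * if x ∈ Set.Ioc (c.G m) (c.G (m + 1)) then w (c.D m) else 0 := by
  ext x
  rw [stepInterp, Finset.mul_sum]

lemma intervalIntegrable_mul_stepInterp {g : ℝ → ℝ} (hg : Continuous g) (w : ℝ → ℝ) :
    IntervalIntegrable (fun x => g x * stepInterp k c.G c.D w x) volume (-1) 1 := by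
  rw [mul_stepInterp]
  have h := IntervalIntegrable.sum (Finset.range (k + 1)) fun m _ =>
    intervalIntegrable_mul_piece hg (c.G m) (c.G (m + 1)) (w (c.D m))
  simpa only [Finset.sum_fn] using h

lemma integral_mul_stepInterp {g : ℝ → ℝ} (hg : Continuous g) (w : ℝ → ℝ) :
    ∫ x in (-1:ℝ)..1, g x * stepInterp k c.G c.D w x
      = ∑ m ∈ Finset.range (k + 1), w (c.D m) * ∫ x in c.G m..c.G (m + 1), g x := by
  rw [mul_stepInterp, integral_finsetSum fun m _ => intervalIntegrable_mul_piece hg _ _ _]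
  refine Finset.sum_congr rfl fun m hm => ?_
  have hm' : m ≤ k := by simpa [Nat.lt_succ_iff] using hm
  exact integral_mul_piece g (c.neg_one_le_G (by omega)) (c.G_mono m hm').le
    (c.G_le_one (by omega)) _

/-- The functional `g ↦ ∫ g (x - Πx)`, with the integral against `Πx` written piecewise. -/
noncomputable def defect : ℝ[X] →ₗ[ℝ] ℝ where
  toFun g := (∫ x in (-1:ℝ)..1, g.eval x * x)
    - ∑ m ∈ Finset.range (k + 1), c.D m * ∫ x in c.G m..c.G (m + 1), g.eval x
  map_add' f g := by
    have h (u v : ℝ) : ∫ x in u..v, (f + g).eval x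
        = (∫ x in u..v, f.eval x) + ∫ x in u..v, g.eval x := by
      simp only [eval_add]
      exact integral_add (f.continuous.intervalIntegrable _ _) (g.continuous.intervalIntegrable _ _)
    have h' : ∫ x in (-1:ℝ)..1, (f + g).eval x * x
        = (∫ x in (-1:ℝ)..1, f.eval x * x) + ∫ x in (-1:ℝ)..1, g.eval x * x := by
      simp only [eval_add, add_mul]
      exact integral_add ((f.continuous.mul continuous_id).intervalIntegrable _ _)
        ((g.continuous.mul continuous_id).intervalIntegrable _ _)
    simp only [h, h', mul_add, Finset.sum_add_distrib]
    ring
  map_smul' t g := by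
    simp only [eval_smul, smul_eq_mul, mul_assoc, intervalIntegral.integral_const_mul,
      RingHom.id_apply, mul_sub, Finset.mul_sum]
    congr 1
    exact Finset.sum_congr rfl fun m _ => by ring

/-- Only the slope of the linear function `w` matters, since `Π` reproduces constants. -/
lemma integral_mul_sub_stepInterp_s1 (g : ℝ[X]) (u v : ℝ) :
    ∫ x in (-1:ℝ)..1, g.eval x * ((u * x + v) - stepInterp k c.G c.D (fun t => u * t + v) x)
      = u * c.defect g := by
  have hg := g.continuous
  have hsum : ∑ m ∈ Finset.range (k + 1), ∫ x in c.G m..c.G (m + 1), g.eval x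
      = ∫ x in (-1:ℝ)..1, g.eval x := by
    rw [sum_integral_adjacent_intervals fun m _ => hg.intervalIntegrable _ _, c.G_zero, c.G_last]
  simp only [mul_sub]
  rw [integral_sub (Continuous.intervalIntegrable (by fun_prop) _ _)
    (c.intervalIntegrable_mul_stepInterp hg _), c.integral_mul_stepInterp hg]
  have hlin : ∫ x in (-1:ℝ)..1, g.eval x * (u * x + v)
      = u * (∫ x in (-1:ℝ)..1, g.eval x * x) + v * ∫ x in (-1:ℝ)..1, g.eval x := by
    rw [← intervalIntegral.integral_const_mul, ← intervalIntegral.integral_const_mul,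
      ← integral_add (Continuous.intervalIntegrable (by fun_prop) _ _)
        (Continuous.intervalIntegrable (by fun_prop) _ _)]
    exact integral_congr fun x _ => by ring
  simp only [hlin, add_mul, Finset.sum_add_distrib, mul_assoc, ← Finset.mul_sum, hsum, defect,
    LinearMap.coe_mk, AddHom.coe_mk]
  ring

lemma orthCond_iff_defect_X_pow (r : ℕ) :
    OrthCond k r c ↔ ∀ n ≤ r, c.defect (X ^ n) = 0 := by
  constructor
  · intro h n hn
    have := h (X ^ n) X ((degree_X_pow_le n).trans (by exact_mod_cast hn)) degree_X_le
    rw [← one_mul (c.defect _), ← c.integral_mul_sub_stepInterp_s1 (X ^ n) 1 0]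
    simpa using this
  · intro h g w hg hw
    obtain ⟨u, v, rfl⟩ := exists_eq_X_add_C_of_natDegree_le_one (natDegree_le_of_degree_le hw)
    have hker : degreeLE ℝ r ≤ LinearMap.ker c.defect := by
      rw [degreeLE_eq_span_X_pow, Submodule.span_le]
      intro p hp
      simp only [Finset.coe_image, Set.mem_image, Finset.mem_coe, Finset.mem_range] at hp
      obtain ⟨n, hn, rfl⟩ := hp
      exact h n (by omega)
    have hdef : c.defect g = 0 := hker (mem_degreeLE.2 hg)
    simpa [hdef] using c.integral_mul_sub_stepInterp_s1 g u v

/-- The sum of the nodes weighted by the increments of `x ^ (n + 1)` between dual points. -/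
noncomputable def nodeMoment (n : ℕ) : ℝ :=
  ∑ m ∈ Finset.range (k + 1), c.D m * (c.G (m + 1) ^ (n + 1) - c.G m ^ (n + 1))

lemma defect_X_pow (n : ℕ) :
    c.defect (X ^ n) = (1 - (-1) ^ (n + 2)) / ((n : ℝ) + 2) - c.nodeMoment n / ((n : ℝ) + 1) := by
  simp only [defect, nodeMoment, LinearMap.coe_mk, AddHom.coe_mk, eval_pow, eval_X, ← pow_succ,
    integral_pow, Finset.sum_div, one_pow, mul_div_assoc]
  push_cast
  congr 2
  ring

lemma node_term_reflect (n : ℕ) {m : ℕ} (hm : m ≤ k) :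
    c.D (k - m) * (c.G (k - m + 1) ^ (n + 1) - c.G (k - m) ^ (n + 1))
      = (-1) ^ (n + 1) * (c.D m * (c.G (m + 1) ^ (n + 1) - c.G m ^ (n + 1))) := by
  have hD := c.D_symm m hm
  have h₁ := c.G_reflect (m := m) (by omega)
  have h₂ := c.G_reflect (m := m + 1) (by omega)
  rw [show k + 1 - m = k - m + 1 by omega] at h₁
  rw [show k + 1 - (m + 1) = k - m by omega] at h₂
  rw [h₁, h₂, hD, neg_pow (c.G m), neg_pow (c.G (m + 1))]
  ring

lemma nodeMoment_reflect (n : ℕ) : c.nodeMoment n = (-1) ^ (n + 1) * c.nodeMoment n := by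
  conv_lhs => rw [nodeMoment, ← Finset.sum_range_reflect]
  rw [nodeMoment, Finset.mul_sum]
  refine Finset.sum_congr rfl fun m hm => ?_
  rw [Nat.add_sub_cancel]
  exact c.node_term_reflect n (by simpa [Nat.lt_succ_iff] using hm)

lemma defect_X_pow_of_even {n : ℕ} (hn : Even n) : c.defect (X ^ n) = 0 := by
  have h := c.nodeMoment_reflect n
  rw [hn.add_one.neg_one_pow] at h
  rw [defect_X_pow, (hn.add even_two).neg_one_pow, show c.nodeMoment n = 0 by linarith]
  simp

/-- For odd `n` and `k + 1 = 2 l`, the two halves of the node moment agree. -/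
lemma nodeMoment_of_odd {n l : ℕ} (hn : Odd n) (hk : k + 1 = 2 * l) :
    c.nodeMoment n
      = 2 * ∑ m ∈ Finset.range l, c.D m * (c.G (m + 1) ^ (n + 1) - c.G m ^ (n + 1)) := by
  rw [nodeMoment, hk, two_mul l, Finset.sum_range_add, two_mul, add_right_inj,
    ← Finset.sum_range_reflect]
  refine Finset.sum_congr rfl fun m hm => ?_
  have hm' : m < l := by simpa using hm
  have h := c.node_term_reflect n (m := m) (by omega)
  rw [hn.add_one.neg_one_pow, one_mul] at h
  rw [← h, show l + (l - 1 - m) = k - m by omega]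

end SymmConfig

/-- odd order `k = 2l-1`.  The `k`-`r`-order orthogonal condition is
equivalent to the equations (eq:orth_eqs_odd1). -/
theorem orthCond_iff_eqs_odd (l : ℕ) (hl : 2 ≤ l) (k : ℕ) (hk : k = 2 * l - 1)
    (α a : ℕ → ℝ)
    (hα1 : α 1 < 1) (hαpos : 0 < α (l - 1))
    (hαmono : ∀ j, 1 ≤ j → j < l - 1 → α (j + 1) < α j)
    (ha1 : a 1 < 1) (hapos : 0 < a (l - 1))
    (hamono : ∀ j, 1 ≤ j → j < l - 1 → a (j + 1) < a j)
    (c : SymmConfig k)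
    (hG : ∀ j, 1 ≤ j → j ≤ l - 1 → c.G j = -α j ∧ c.G (k + 1 - j) = α j)
    (hGl : c.G l = 0)
    (hD : ∀ j, 1 ≤ j → j ≤ l - 1 → c.D j = -a j ∧ c.D (k - j) = a j)
    (r : ℕ) (hr : 1 ≤ r) :
    OrthCond k r c ↔
      ∀ i : ℕ, Odd i → 1 ≤ i → i ≤ r →
        (1 - α 1 ^ (i + 1))
          + (∑ j ∈ Finset.Icc 1 (l - 2), a j * (α j ^ (i + 1) - α (j + 1) ^ (i + 1)))
          + a (l - 1) * α (l - 1) ^ (i + 1)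
          = ((i : ℝ) + 1) / ((i : ℝ) + 2) := by
  have hhalf {n : ℕ} (hn : Odd n) :
      c.nodeMoment n = 2 * ((1 - α 1 ^ (n + 1))
        + (∑ j ∈ Finset.Icc 1 (l - 2), a j * (α j ^ (n + 1) - α (j + 1) ^ (n + 1)))
        + a (l - 1) * α (l - 1) ^ (n + 1)) := by
    have hpow (x : ℝ) : (-x) ^ (n + 1) = x ^ (n + 1) := hn.add_one.neg_pow x
    rw [c.nodeMoment_of_odd hn (l := l) (by omega)]
    obtain ⟨p, rfl⟩ : ∃ p, l = p + 2 := ⟨l - 2, by omega⟩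
    simp only [show p + 2 - 1 = p + 1 by omega, Nat.add_sub_cancel] at *
    have hmid : ∑ m ∈ Finset.range p,
          c.D (m + 1) * (c.G (m + 1 + 1) ^ (n + 1) - c.G (m + 1) ^ (n + 1))
        = ∑ j ∈ Finset.Icc 1 p, a j * (α j ^ (n + 1) - α (j + 1) ^ (n + 1)) := by
      rw [← Finset.Ico_add_one_right_eq_Icc, Finset.sum_Ico_eq_sum_range]
      refine Finset.sum_congr (by simp) fun m hm => ?_
      have hm' : m < p := by simpa using hm
      rw [(hD (m + 1) (by omega) (by omega)).1, (hG (m + 1) (by omega) (by omega)).1,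
        (hG (m + 1 + 1) (by omega) (by omega)).1, hpow, hpow, add_comm 1 m]
      ring
    rw [Finset.sum_range_succ, Finset.sum_range_succ', hmid, c.D_zero, c.G_zero, hGl, zero_add,
      (hG 1 (by omega) (by omega)).1, (hD (p + 1) (by omega) (by omega)).1,
      (hG (p + 1) (by omega) (by omega)).1, hpow, hpow, hpow, one_pow,
      zero_pow n.succ_ne_zero]
    ring
  rw [c.orthCond_iff_defect_X_pow]
  have hodd {n : ℕ} (hn : Odd n) : c.defect (X ^ n) = 0 ↔
      (1 - α 1 ^ (n + 1))
        + (∑ j ∈ Finset.Icc 1 (l - 2), a j * (α j ^ (n + 1) - α (j + 1) ^ (n + 1)))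
        + a (l - 1) * α (l - 1) ^ (n + 1) = ((n : ℝ) + 1) / ((n : ℝ) + 2) := by
    rw [c.defect_X_pow, hhalf hn, (hn.add_even even_two).neg_one_pow, sub_eq_zero,
      div_eq_div_iff (by positivity) (by positivity), eq_div_iff (by positivity)]
    constructor <;> intro h <;> linarith
  constructor
  · exact fun h i hi _ hir => (hodd hi).1 (h i hir)
  · intro h n hnr
    rcases n.even_or_odd with hn | hn
    · exact c.defect_X_pow_of_even hn
    · exact (hodd hn).2 (h n hn hn.pos hnr)
end

section
/- For all natural numbers i and j with i ≠ j, i ≠ j + 2, and j ≠ i + 2, the M-polynomials M̂_i and M̂_j are L²-orthogonal on the reference element: ∫_{−1}^{1} M̂_i(ξ)·M̂_j(ξ) dξ = 0. -/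
open Polynomial

/-- The M-polynomials `M̂ i` on `[-1,1]`:  `M̂ 0 = 1`, `M̂ 1 = ξ`, and
`M̂ (i+1) = (1/(2^i i)) (d/dξ)^(i-1) (ξ² - 1)^i` for `i ≥ 1`. -/
noncomputable def Mhat : ℕ → Polynomial ℝ
  | 0 => 1
  | 1 => Polynomial.X
  | (i + 2) =>
      Polynomial.C (1 / ((2:ℝ) ^ (i + 1) * (i + 1))) *
        ((fun q => Polynomial.derivative q)^[i] ((Polynomial.X ^ 2 - 1) ^ (i + 1)))

theorem Mhat_add_two (i : ℕ) :
    Mhat (i + 2) = C (1 / ((2:ℝ) ^ (i + 1) * (i + 1))) *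
      derivative^[i] ((X ^ 2 - 1) ^ (i + 1)) := rfl

theorem natDegree_Mhat_le (i : ℕ) : (Mhat i).natDegree ≤ i := by
  match i with
  | 0 => simp [Mhat]
  | 1 => simp [Mhat]
  | i + 2 =>
    rw [Mhat_add_two]
    refine (natDegree_C_mul_le _ _).trans ((natDegree_iterate_derivative _ _).trans ?_)
    have h : ((X ^ 2 - 1 : ℝ[X]) ^ (i + 1)).natDegree ≤ (i + 1) * 2 :=
      natDegree_pow_le_of_le _ (by compute_degree)
    omega

theorem iterate_derivative_comp_neg_X {R : Type*} [CommRing R] (p : R[X]) (k : ℕ) :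
    (derivative^[k] p).comp (-X) = (-1) ^ k * derivative^[k] (p.comp (-X)) := by
  induction k generalizing p with
  | zero => simp
  | succ k ih =>
    have h : p.derivative.comp (-X) = -derivative (p.comp (-X)) := by
      simp [derivative_comp]
    rw [Function.iterate_succ_apply, ih, h, Function.iterate_succ_apply, iterate_derivative_neg]
    ring

theorem Mhat_comp_neg_X (i : ℕ) : (Mhat i).comp (-X) = (-1) ^ i * Mhat i := by
  match i with
  | 0 => simp [Mhat]
  | 1 => simp [Mhat]
  | i + 2 =>
    rw [Mhat_add_two, mul_comp, C_comp, iterate_derivative_comp_neg_X]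
    simp only [pow_comp, sub_comp, X_comp, one_comp, neg_sq]
    ring

theorem Mhat_eval_neg (i : ℕ) (x : ℝ) : (Mhat i).eval (-x) = (-1) ^ i * (Mhat i).eval x := by
  simpa using congrArg (eval x) (Mhat_comp_neg_X i)

theorem eval_iterate_derivative_sq_sub_one_pow {R : Type*} [CommRing R] {m n : ℕ} (h : m < n)
    {a : R} (ha : a ^ 2 = 1) : (derivative^[m] ((X ^ 2 - 1 : R[X]) ^ n)).eval a = 0 := by
  refine eval_eq_zero_of_dvd_of_eval_eq_zero
    ((dvd_pow_self _ (Nat.sub_ne_zero_of_lt h)).trans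
      (pow_sub_dvd_iterate_derivative_pow (X ^ 2 - 1 : R[X]) n m)) ?_
  simp [ha]

/-- The `m`-th derivative of `(x² - 1) ^ n`, for `m ≤ n`, is orthogonal on `[-1, 1]` to all
polynomials of degree less than `m`. -/
theorem integral_mul_iterate_derivative_sq_sub_one_pow {m n : ℕ} (hmn : m ≤ n) (p : ℝ[X])
    (hp : p.degree < m) :
    ∫ x in (-1:ℝ)..1, p.eval x * (derivative^[m] ((X ^ 2 - 1) ^ n)).eval x = 0 := by
  induction m generalizing p with
  | zero =>
    obtain rfl : p = 0 := by
      simpa [Nat.WithBot.lt_zero_iff] using hp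
    simp
  | succ m ih =>
    have hd : p.derivative.degree < m := by
      rcases eq_or_ne p 0 with rfl | h0
      · simp
      · have h := degree_derivative_lt h0
        exact h.trans_le (degree_le_of_natDegree_le
          (Nat.lt_succ_iff.mp ((natDegree_lt_iff_degree_lt h0).mpr hp)))
    rw [Function.iterate_succ_apply',
      intervalIntegral.integral_mul_deriv_eq_deriv_mul
        (fun x _ => p.hasDerivAt x) (fun x _ => Polynomial.hasDerivAt _ x)
        (p.derivative.continuous.intervalIntegrable _ _)
        ((Polynomial.continuous _).intervalIntegrable _ _),
      ih (by omega) _ hd, eval_iterate_derivative_sq_sub_one_pow hmn (by norm_num),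
      eval_iterate_derivative_sq_sub_one_pow hmn (by norm_num)]
    simp

theorem integral_Mhat_mul_Mhat_of_add_two_lt {i j : ℕ} (h : i + 2 < j) :
    ∫ x in (-1:ℝ)..1, (Mhat i).eval x * (Mhat j).eval x = 0 := by
  obtain ⟨k, rfl⟩ := Nat.exists_eq_add_of_le' (show 2 ≤ j by omega)
  have hd : (Mhat i).degree < k :=
    degree_le_natDegree.trans_lt (by exact_mod_cast (natDegree_Mhat_le i).trans_lt (by omega))
  simp only [Mhat_add_two, eval_mul, eval_C, mul_left_comm _ (1 / _ : ℝ)]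
  rw [intervalIntegral.integral_const_mul,
    integral_mul_iterate_derivative_sq_sub_one_pow (Nat.le_succ k) _ hd, mul_zero]

theorem integral_Mhat_mul_Mhat_succ (i : ℕ) :
    ∫ x in (-1:ℝ)..1, (Mhat i).eval x * (Mhat (i + 1)).eval x = 0 := by
  have h := intervalIntegral.integral_comp_neg (a := -1) (b := 1)
    (fun x : ℝ => (Mhat i).eval x * (Mhat (i + 1)).eval x)
  have hodd (x : ℝ) : (Mhat i).eval (-x) * (Mhat (i + 1)).eval (-x) =
      -((Mhat i).eval x * (Mhat (i + 1)).eval x) := by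
    have hs : ((-1 : ℝ) ^ i) ^ 2 = 1 := by rw [← pow_mul, mul_comm, pow_mul]; simp
    rw [Mhat_eval_neg, Mhat_eval_neg]
    linear_combination (-(Mhat i).eval x * (Mhat (i + 1)).eval x) * hs
  simp only [hodd, intervalIntegral.integral_neg, neg_neg] at h
  linarith

theorem integral_Mhat_mul_Mhat_of_lt {i j : ℕ} (h : i < j) (h2 : j ≠ i + 2) :
    ∫ x in (-1:ℝ)..1, (Mhat i).eval x * (Mhat j).eval x = 0 := by
  obtain rfl | hlt : j = i + 1 ∨ i + 2 < j := by omega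
  · exact integral_Mhat_mul_Mhat_succ i
  · exact integral_Mhat_mul_Mhat_of_add_two_lt hlt

/-- quasi-orthogonality of the M-polynomials:
`∫_{-1}^{1} M̂ i · M̂ j = 0` whenever `i ≠ j`, `i ≠ j + 2` and `j ≠ i + 2`. -/
theorem Mhat_orthogonal (i j : ℕ) (h1 : i ≠ j) (h2 : i ≠ j + 2) (h3 : j ≠ i + 2) :
    ∫ ξ in (-1:ℝ)..1, (Mhat i).eval ξ * (Mhat j).eval ξ = 0 := by
  rcases h1.lt_or_gt with h | h
  · exact integral_Mhat_mul_Mhat_of_lt h h3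
  · simp only [mul_comm ((Mhat i).eval _)]
    exact integral_Mhat_mul_Mhat_of_lt h h2
end

section
/- Let l ≥ 2 be an integer and let t₁, …, t_{l−1} be nonzero real numbers whose squares t₁², …, t_{l−1}² are pairwise distinct. Then the (l−1)×(l−1) matrix B with entries B_{m,s} = M̂'_{2s}(t_m) (the derivative of the M-polynomial M̂_{2s} evaluated at t_m), for 1 ≤ m, s ≤ l−1, is invertible. -/
open Polynomial

/-- A polynomial with only odd-degree terms factors as `x * q (x ^ 2)`, where `q` collects its odd
coefficients. -/
theorem eval_eq_mul_eval_contract_divX {R : Type*} [CommSemiring R] {p : R[X]}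
    (hp : ∀ n, Even n → p.coeff n = 0) (x : R) :
    p.eval x = x * (p.divX.contract 2).eval (x ^ 2) := by
  have hexp : expand R 2 (p.divX.contract 2) = p.divX := by
    ext n
    rw [coeff_expand two_pos]
    split_ifs with h
    · rw [coeff_contract two_ne_zero, Nat.div_mul_cancel h]
    · rw [coeff_divX, hp _ (by grind)]
  rw [← expand_eval, hexp]
  conv_lhs => rw [← divX_mul_X_add p, hp 0 Even.zero]
  simp [mul_comm]

theorem coeff_X_sub_one_pow_self {R : Type*} [CommRing R] [Nontrivial R] (k : ℕ) :
    ((X - 1 : R[X]) ^ k).coeff k = 1 := by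
  rw [← C_1]
  have h := ((monic_X_sub_C (1 : R)).pow k).coeff_natDegree
  have hd : ((X - C 1 : R[X]) ^ k).natDegree = k := by
    rw [(monic_X_sub_C (1 : R)).natDegree_pow, natDegree_X_sub_C, mul_one]
  rwa [hd] at h

theorem coeff_derivative_Mhat_two_mul_succ (s n : ℕ) :
    (derivative (Mhat (2 * (s + 1)))).coeff n =
      1 / ((2 : ℝ) ^ (2 * s + 1) * ((2 * s : ℕ) + 1)) *
        if 2 ∣ n + (2 * s + 1) then
          ((n + (2 * s + 1)).descFactorial (2 * s + 1) : ℝ) *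
            ((X - 1 : ℝ[X]) ^ (2 * s + 1)).coeff ((n + (2 * s + 1)) / 2)
        else 0 := by
  have hexp : (X ^ 2 - 1 : ℝ[X]) ^ (2 * s + 1) = expand ℝ 2 ((X - 1) ^ (2 * s + 1)) := by simp
  rw [show 2 * (s + 1) = 2 * s + 2 by ring, Mhat, derivative_C_mul, coeff_C_mul,
    ← Function.iterate_succ_apply' (fun q : ℝ[X] => derivative q), hexp]
  congr 1
  refine (coeff_iterate_derivative _ _).trans ?_
  rw [coeff_expand two_pos, nsmul_eq_mul, mul_ite, mul_zero]

/-- the matrix `B (m, s) = M̂'_{2s}(t m)` (for `1 ≤ m, s ≤ l-1`) is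
invertible whenever the `t m` are nonzero with pairwise distinct squares. -/
theorem Mhat_deriv_matrix_invertible (l : ℕ) (hl : 2 ≤ l) (t : Fin (l - 1) → ℝ)
    (ht : ∀ m, t m ≠ 0)
    (htinj : ∀ m m', t m ^ 2 = t m' ^ 2 → m = m') :
    IsUnit (Matrix.of fun m s : Fin (l - 1) =>
      (Polynomial.derivative (Mhat (2 * ((s : ℕ) + 1)))).eval (t m)) := by
  have hcoeff : ∀ s : Fin (l - 1), ((derivative (Mhat (2 * ((s : ℕ) + 1)))).divX.contract 2).coeff s
      ≠ 0 := fun s => by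
    rw [coeff_contract two_ne_zero, coeff_divX, mul_comm (s : ℕ) 2, coeff_derivative_Mhat_two_mul_succ]
    have hd : (2 * (s : ℕ) + 1 + (2 * s + 1)).descFactorial (2 * s + 1) ≠ 0 :=
      (Nat.descFactorial_pos.mpr (by omega)).ne'
    rw [if_pos (by omega), show (2 * (s : ℕ) + 1 + (2 * s + 1)) / 2 = 2 * s + 1 by omega,
      coeff_X_sub_one_pow_self]
    have hd_cast := (Nat.cast_ne_zero (R := ℝ)).mpr hd
    push_cast
    positivity
  have hdeg : ∀ s : Fin (l - 1),
      ((derivative (Mhat (2 * ((s : ℕ) + 1)))).divX.contract 2).natDegree ≤ s := fun s => by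
    rw [natDegree_le_iff_coeff_eq_zero]
    intro j hj
    rw [coeff_contract two_ne_zero, coeff_divX, coeff_derivative_Mhat_two_mul_succ,
      if_pos (by omega), coeff_eq_zero_of_natDegree_lt (p := (X - 1 : ℝ[X]) ^ _), mul_zero, mul_zero]
    rw [show (X - 1 : ℝ[X]) = X - C 1 by simp, natDegree_pow, natDegree_X_sub_C]
    omega
  have heq : (Matrix.of fun m s : Fin (l - 1) =>
      (derivative (Mhat (2 * ((s : ℕ) + 1)))).eval (t m)) =
      Matrix.diagonal t * Matrix.of fun m s : Fin (l - 1) =>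
        ((derivative (Mhat (2 * ((s : ℕ) + 1)))).divX.contract 2).eval (t m ^ 2) := by
    ext m s
    rw [Matrix.diagonal_mul, Matrix.of_apply, Matrix.of_apply]
    refine eval_eq_mul_eval_contract_divX (fun n hn => ?_) _
    rw [coeff_derivative_Mhat_two_mul_succ, if_neg (by have := hn.two_dvd; omega), mul_zero]
  rw [Matrix.isUnit_iff_isUnit_det, isUnit_iff_ne_zero, heq, Matrix.det_mul, Matrix.det_diagonal,
    Matrix.eval_matrixOfPolynomials_eq_vandermonde_mul_matrixOfPolynomials (fun m => t m ^ 2)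
      (fun s : Fin (l - 1) => (derivative (Mhat (2 * ((s : ℕ) + 1)))).divX.contract 2) hdeg,
    Matrix.det_mul, Matrix.det_of_isUpperTriangular (Matrix.matrixOfPolynomials_blockTriangular _ hdeg)]
  exact mul_ne_zero (Finset.prod_ne_zero_iff.mpr fun m _ => ht m)
    (mul_ne_zero (Matrix.det_vandermonde_ne_zero_iff.mpr htinj)
      (Finset.prod_ne_zero_iff.mpr fun s _ => hcoeff s))
end

section
/- For the quadratic (k = 2, l = 1) case: let α₁ ∈ (0,1) and consider the symmetric configuration with dual points G₁ = −α₁, G₂ = α₁ and interpolation nodes D₀ = −1, D₁ = 0, D₂ = 1. This configuration satisfies the 2-1-order orthogonal condition if and only if α₁ = √3/3. -/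
open Polynomial

theorem intervalIntegral_of_eqOn_mul {f : ℝ → ℝ} {u v a b q d : ℝ} (huv : u ≤ v)
    (hf : ∀ x ∈ Set.Ioc u v, f x = (b * x + a) * (q * (x - d))) :
    IntervalIntegrable f MeasureTheory.volume u v ∧
      ∫ x in u..v, f x = q * (b * (v ^ 3 - u ^ 3) / 3 + (a - b * d) * (v ^ 2 - u ^ 2) / 2
        - a * d * (v - u)) := by
  have hcont : Continuous fun x : ℝ => (b * x + a) * (q * (x - d)) := by fun_prop
  refine ⟨(hcont.intervalIntegrable u v).congr fun x hx => ?_, ?_⟩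
  · rw [Set.uIoc_of_le huv] at hx
    exact (hf x hx).symm
  · have hderiv : ∀ x ∈ Set.uIcc u v,
        HasDerivAt (fun x : ℝ => q * (b * x ^ 3 / 3 + (a - b * d) * x ^ 2 / 2 - a * d * x))
          ((b * x + a) * (q * (x - d))) x := by
      intro x _
      have h := (((((hasDerivAt_pow 3 x).const_mul b).div_const 3).add
        (((hasDerivAt_pow 2 x).const_mul (a - b * d)).div_const 2)).sub
        ((hasDerivAt_id x).const_mul (a * d))).const_mul q
      refine h.congr_deriv ?_
      push_cast
      ring
    have hcongr : ∫ x in u..v, f x = ∫ x in u..v, (b * x + a) * (q * (x - d)) := by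
      refine intervalIntegral.integral_congr_ae (Filter.Eventually.of_forall fun x hx => ?_)
      rw [Set.uIoc_of_le huv] at hx
      exact hf x hx
    rw [hcongr, intervalIntegral.integral_eq_sub_of_hasDerivAt hderiv
      (hcont.intervalIntegrable u v)]
    ring

/-- The integral of an affine function against the interpolation error of an affine function,
for dual points `±α` and nodes `-1, 0, 1`. -/
theorem integral_affine_mul_sub_stepInterp {α : ℝ} (hα0 : 0 < α) (hα1 : α < 1)
    (c : SymmConfig 2) (hG1 : c.G 1 = -α) (hG2 : c.G 2 = α) (hD1 : c.D 1 = 0)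
    (a b p q : ℝ) :
    ∫ x in (-1 : ℝ)..1,
      (b * x + a) * (q * x + p - stepInterp 2 c.G c.D (fun t => q * t + p) x) =
        b * q * (α ^ 2 - 1 / 3) := by
  have hG0 := c.G_zero
  have hG3 : c.G 3 = 1 := c.G_last
  have hD0 := c.D_zero
  have hD2 := c.D_last
  set f : ℝ → ℝ := fun x =>
    (b * x + a) * (q * x + p - stepInterp 2 c.G c.D (fun t => q * t + p) x) with hf
  have hstep : ∀ x, stepInterp 2 c.G c.D (fun t => q * t + p) x =
      (if -1 < x ∧ x ≤ -α then q * -1 + p else 0) + (if -α < x ∧ x ≤ α then q * 0 + p else 0)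
        + (if α < x ∧ x ≤ 1 then q * 1 + p else 0) := by
    intro x
    simp only [stepInterp, Finset.sum_range_succ, Finset.sum_range_zero, Set.mem_Ioc, zero_add,
      Nat.reduceAdd, hG0, hG1, hG2, hG3, hD0, hD1, hD2]
  obtain ⟨i₁, e₁⟩ := intervalIntegral_of_eqOn_mul (f := f) (u := -1) (v := -α) (a := a) (b := b)
    (q := q) (d := -1) (by linarith) (by
      rintro x ⟨h₁, h₂⟩
      simp only [hf, hstep]
      rw [if_pos ⟨h₁, h₂⟩, if_neg (fun h => by linarith [h.1]),
        if_neg (fun h => by linarith [h.1])]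
      ring)
  obtain ⟨i₂, e₂⟩ := intervalIntegral_of_eqOn_mul (f := f) (u := -α) (v := α) (a := a) (b := b)
    (q := q) (d := 0) (by linarith) (by
      rintro x ⟨h₁, h₂⟩
      simp only [hf, hstep]
      rw [if_neg (fun h => by linarith [h.2]), if_pos ⟨h₁, h₂⟩,
        if_neg (fun h => by linarith [h.1])]
      ring)
  obtain ⟨i₃, e₃⟩ := intervalIntegral_of_eqOn_mul (f := f) (u := α) (v := 1) (a := a) (b := b)
    (q := q) (d := 1) (by linarith) (by
      rintro x ⟨h₁, h₂⟩
      simp only [hf, hstep]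
      rw [if_neg (fun h => by linarith [h.2]), if_neg (fun h => by linarith [h.2]),
        if_pos ⟨h₁, h₂⟩]
      ring)
  rw [← intervalIntegral.integral_add_adjacent_intervals (i₁.trans i₂) i₃,
    ← intervalIntegral.integral_add_adjacent_intervals i₁ i₂, e₁, e₂, e₃]
  ring

/-- quadratic case `k = 2`.  The configuration with dual points
`±α₁` and nodes `-1, 0, 1` satisfies the 2-1-order orthogonal condition iff
`α₁ = √3/3`. -/
theorem orthCond_quadratic (α : ℝ) (hα0 : 0 < α) (hα1 : α < 1)
    (c : SymmConfig 2)
    (hG1 : c.G 1 = -α) (hG2 : c.G 2 = α) (hD1 : c.D 1 = 0) :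
    OrthCond 2 1 c ↔ α = Real.sqrt 3 / 3 := by
  have key := integral_affine_mul_sub_stepInterp hα0 hα1 c hG1 hG2 hD1
  have h3 : Real.sqrt 3 ^ 2 = 3 := Real.sq_sqrt (by norm_num)
  constructor
  · intro h
    have hX := h X X (by simp) (by simp)
    have hk := key 0 1 0 1
    simp only [eval_X] at hX
    simp only [one_mul, add_zero] at hk
    rw [hX] at hk
    refine (pow_left_inj₀ hα0.le (by positivity) two_ne_zero).mp ?_
    rw [div_pow, h3]
    linarith
  · rintro hα g w hg hw
    have hk := key (g.coeff 0) (g.coeff 1) (w.coeff 0) (w.coeff 1)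
    have hα2 : α ^ 2 - 1 / 3 = 0 := by
      rw [hα, div_pow, h3]
      norm_num
    rw [hα2, mul_zero] at hk
    rw [eq_X_add_C_of_degree_le_one hw,
      eq_X_add_C_of_degree_le_one (p := g) (by exact_mod_cast hg)]
    simpa only [eval_add, eval_mul, eval_C, eval_X] using hk
end

section
/- For the cubic (k = 3, l = 2) case: let α₁, a₁ ∈ (0,1) and consider the symmetric configuration with dual points G₁ = −α₁, G₂ = 0, G₃ = α₁ and interpolation nodes D₀ = −1, D₁ = −a₁, D₂ = a₁, D₃ = 1. This configuration satisfies the 3-3-order orthogonal condition if and only if α₁ = √(3/5) and a₁ = 4/9. Equivalently, the pair of equations (1 − α₁²) + a₁·α₁² = 2/3 and (1 − α₁⁴) + a₁·α₁⁴ = 4/5 has, among pairs (α₁, a₁) ∈ (0,1)², the unique solution α₁ = √(3/5), a₁ = 4/9. -/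
open Polynomial

/-- On an interval where `f` agrees with a continuous function `p`, it is integrable with the
same integral. -/
lemma hasIntervalIntegral_of_eqOn_Ioc {f p : ℝ → ℝ} {u v : ℝ} (huv : u ≤ v)
    (hp : Continuous p) (h : Set.EqOn p f (Set.Ioc u v)) :
    IntervalIntegrable f MeasureTheory.volume u v ∧ ∫ x in u..v, f x = ∫ x in u..v, p x := by
  rw [← Set.uIoc_of_le huv] at h
  exact ⟨(hp.intervalIntegrable u v).congr h,
    (intervalIntegral.integral_congr_ae (.of_forall fun _ hx => h hx)).symm⟩

lemma stepInterp_three_eq {G D : ℕ → ℝ} (h1 : G 1 < G 2) (h2 : G 2 < G 3)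
    (w : ℝ → ℝ) {m : ℕ} (hm : m < 4) {x : ℝ}
    (hx : x ∈ Set.Ioc (G m) (G (m + 1))) : stepInterp 3 G D w x = w (D m) := by
  obtain ⟨hl, hr⟩ := hx
  unfold stepInterp
  rw [Finset.sum_eq_single_of_mem m (by simpa using hm), if_pos ⟨hl, hr⟩]
  intro j hj hjm
  rw [if_neg]
  rintro ⟨hl', hr'⟩
  rw [Finset.mem_range] at hj
  interval_cases m <;> interval_cases j <;> first | exact hjm rfl | (norm_num at *; linarith)

lemma integral_cubic_mul_sub (c₀ c₁ c₂ c₃ t d u v : ℝ) :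
    ∫ x in u..v, (c₀ + c₁ * x + c₂ * x ^ 2 + c₃ * x ^ 3) * (t * (x - d)) =
      t * ((c₀ * v ^ 2 / 2 + c₁ * v ^ 3 / 3 + c₂ * v ^ 4 / 4 + c₃ * v ^ 5 / 5
          - d * (c₀ * v + c₁ * v ^ 2 / 2 + c₂ * v ^ 3 / 3 + c₃ * v ^ 4 / 4))
        - (c₀ * u ^ 2 / 2 + c₁ * u ^ 3 / 3 + c₂ * u ^ 4 / 4 + c₃ * u ^ 5 / 5
          - d * (c₀ * u + c₁ * u ^ 2 / 2 + c₂ * u ^ 3 / 3 + c₃ * u ^ 4 / 4))) := by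
  rw [mul_sub]
  refine intervalIntegral.integral_eq_sub_of_hasDerivAt
    (f := fun x => t * (c₀ * x ^ 2 / 2 + c₁ * x ^ 3 / 3 + c₂ * x ^ 4 / 4 + c₃ * x ^ 5 / 5
          - d * (c₀ * x + c₁ * x ^ 2 / 2 + c₂ * x ^ 3 / 3 + c₃ * x ^ 4 / 4)))
    (fun x _ => ?_) (Continuous.intervalIntegrable (by fun_prop) _ _)
  have hpow (n : ℕ) (c : ℝ) := ((hasDerivAt_pow n x).const_mul c).div_const (n : ℝ)
  refine (((((hpow 2 c₀).add (hpow 3 c₁)).add (hpow 4 c₂)).add (hpow 5 c₃)).sub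
    ((((((hasDerivAt_id x).const_mul c₀).add (hpow 2 c₁)).add (hpow 3 c₂)).add
      (hpow 4 c₃)).const_mul d)).const_mul t |>.congr_deriv ?_
  norm_num
  ring

/-- The orthogonality defect of a cubic `g` against an affine `w`. -/
lemma integral_mul_sub_stepInterp_three {α a : ℝ} (c : SymmConfig 3)
    (hG1 : c.G 1 = -α) (hG2 : c.G 2 = 0) (hG3 : c.G 3 = α)
    (hD1 : c.D 1 = -a) (hD2 : c.D 2 = a) {g w : ℝ → ℝ} {c₀ c₁ c₂ c₃ s t : ℝ}
    (hg : ∀ x, g x = c₀ + c₁ * x + c₂ * x ^ 2 + c₃ * x ^ 3) (hw : ∀ x, w x = s + t * x) :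
    ∫ x in (-1 : ℝ)..1, g x * (w x - stepInterp 3 c.G c.D w x) =
      t * (c₁ * (2 / 3 - ((1 - α ^ 2) + a * α ^ 2)) +
        c₃ / 2 * (4 / 5 - ((1 - α ^ 4) + a * α ^ 4))) := by
  have hG0 := c.G_zero
  have hG4 : c.G 4 = 1 := c.G_last
  have hD0 := c.D_zero
  have hD3 := c.D_last
  have piece (m : ℕ) (hm : m < 4) := hasIntervalIntegral_of_eqOn_Ioc
    (f := fun x => g x * (w x - stepInterp 3 c.G c.D w x))
    (p := fun x => (c₀ + c₁ * x + c₂ * x ^ 2 + c₃ * x ^ 3) * (t * (x - c.D m)))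
    (c.G_mono m (by omega)).le (by fun_prop) (fun x hx => by
      have hstep := stepInterp_three_eq (D := c.D) (c.G_mono 1 (by omega))
        (c.G_mono 2 (by omega)) w hm hx
      simp only [hstep, hg, hw]
      ring)
  have p0 := piece 0 (by omega)
  have p1 := piece 1 (by omega)
  have p2 := piece 2 (by omega)
  have p3 := piece 3 (by omega)
  simp only [zero_add, Nat.reduceAdd, hG0, hG1, hG2, hG3, hG4, hD0, hD1, hD2, hD3,
    integral_cubic_mul_sub] at p0 p1 p2 p3
  rw [← intervalIntegral.integral_add_adjacent_intervals
      ((p0.1.trans p1.1).trans p2.1) p3.1,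
    ← intervalIntegral.integral_add_adjacent_intervals (p0.1.trans p1.1) p2.1,
    ← intervalIntegral.integral_add_adjacent_intervals p0.1 p1.1, p0.2, p1.2, p2.2, p3.2]
  ring

lemma cubic_moment_equations_iff {α a : ℝ} (hα0 : 0 < α) :
    ((1 - α ^ 2) + a * α ^ 2 = 2 / 3 ∧ (1 - α ^ 4) + a * α ^ 4 = 4 / 5) ↔
      (α = Real.sqrt (3 / 5) ∧ a = 4 / 9) := by
  constructor
  · rintro ⟨h1, h2⟩
    have hsq : α ^ 2 = 3 / 5 := by linear_combination 3 * α ^ 2 * h1 - 3 * h2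
    refine ⟨?_, ?_⟩
    · rw [← hsq, Real.sqrt_sq hα0.le]
    · rw [hsq] at h1
      linarith
  · rintro ⟨h, rfl⟩
    have hsq : α ^ 2 = 3 / 5 := by rw [h, Real.sq_sqrt (by norm_num)]
    have h4 : α ^ 4 = 9 / 25 := by rw [show α ^ 4 = (α ^ 2) ^ 2 by ring, hsq]; norm_num
    rw [hsq, h4]
    norm_num

/-- cubic case `k = 3`.  The configuration with dual points
`-α₁, 0, α₁` and nodes `-1, -a₁, a₁, 1` satisfies the 3-3-order orthogonal
condition iff `α₁ = √(3/5)` and `a₁ = 4/9`; equivalently, the corresponding pair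
of equations has a unique solution in `(0,1)²`. -/
theorem orthCond_cubic (α a : ℝ) (hα0 : 0 < α) (hα1 : α < 1)
    (ha0 : 0 < a) (ha1 : a < 1)
    (c : SymmConfig 3)
    (hG1 : c.G 1 = -α) (hG2 : c.G 2 = 0) (hG3 : c.G 3 = α)
    (hD1 : c.D 1 = -a) (hD2 : c.D 2 = a) :
    (OrthCond 3 3 c ↔ (α = Real.sqrt (3 / 5) ∧ a = 4 / 9)) ∧
    (∀ α' a' : ℝ, 0 < α' → α' < 1 → 0 < a' → a' < 1 →
      (((1 - α' ^ 2) + a' * α' ^ 2 = 2 / 3 ∧ (1 - α' ^ 4) + a' * α' ^ 4 = 4 / 5) ↔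
        (α' = Real.sqrt (3 / 5) ∧ a' = 4 / 9))) := by
  refine ⟨?_, fun α' a' h _ _ _ => cubic_moment_equations_iff h⟩
  rw [← cubic_moment_equations_iff hα0]
  constructor
  · intro h
    have hX : (X : ℝ[X]).degree ≤ 1 := degree_X_le
    have h1 := h X X (hX.trans (by norm_num)) hX
    have h3 := h (X ^ 3) X (degree_X_pow_le 3) hX
    rw [integral_mul_sub_stepInterp_three c hG1 hG2 hG3 hD1 hD2
      (g := fun x => (X : ℝ[X]).eval x) (w := fun x => (X : ℝ[X]).eval x)
      (c₀ := 0) (c₁ := 1) (c₂ := 0) (c₃ := 0) (s := 0) (t := 1) (by simp) (by simp)] at h1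
    rw [integral_mul_sub_stepInterp_three c hG1 hG2 hG3 hD1 hD2
      (g := fun x => (X ^ 3 : ℝ[X]).eval x) (w := fun x => (X : ℝ[X]).eval x)
      (c₀ := 0) (c₁ := 0) (c₂ := 0) (c₃ := 1) (s := 0) (t := 1) (by simp) (by simp)] at h3
    constructor <;> linarith
  · rintro ⟨h1, h2⟩ g w hg hw
    have hg' (x : ℝ) : g.eval x =
        g.coeff 0 + g.coeff 1 * x + g.coeff 2 * x ^ 2 + g.coeff 3 * x ^ 3 := by
      rw [eval_eq_sum_range' (n := 4)
        (Nat.lt_succ_of_le (natDegree_le_iff_degree_le.mpr hg))]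
      simp [Finset.sum_range_succ]
    have hw' (x : ℝ) : w.eval x = w.coeff 0 + w.coeff 1 * x := by
      rw [eval_eq_sum_range' (n := 2)
        (Nat.lt_succ_of_le (natDegree_le_iff_degree_le.mpr hw))]
      simp [Finset.sum_range_succ]
    rw [integral_mul_sub_stepInterp_three c hG1 hG2 hG3 hD1 hD2 hg' hw', h1, h2]
    ring
end

section
/- Quintic case (k = 5): Suppose real numbers α₁, α₂, a₁, a₂ satisfy 0 < α₂ < α₁ < 1 and 1 > a₁ > a₂ > 0, together with the three equations (1 − a₁)·α₁² + (a₁ − a₂)·α₂² = 1/3, (1 − a₁)·α₁⁴ + (a₁ − a₂)·α₂⁴ = 1/5, and (1 − a₁)·α₁⁶ + (a₁ − a₂)·α₂⁶ = 1/7. Then √(5/7) < α₁ < 1 and α₂ = √( (α₁²/5 − 1/7) / (α₁²/3 − 1/5) ). -/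
/-- quintic case `k = 5`.  The three restrictions equivalent to the
5-5-order orthogonal condition force `√(5/7) < α₁ < 1` and determine `α₂` from `α₁`. -/
theorem quintic_orth_equations (α₁ α₂ a₁ a₂ : ℝ)
    (hα2 : 0 < α₂) (hα21 : α₂ < α₁) (hα1 : α₁ < 1)
    (ha2 : 0 < a₂) (ha21 : a₂ < a₁) (ha1 : a₁ < 1)
    (e1 : (1 - a₁) * α₁ ^ 2 + (a₁ - a₂) * α₂ ^ 2 = 1 / 3)
    (e2 : (1 - a₁) * α₁ ^ 4 + (a₁ - a₂) * α₂ ^ 4 = 1 / 5)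
    (e3 : (1 - a₁) * α₁ ^ 6 + (a₁ - a₂) * α₂ ^ 6 = 1 / 7) :
    Real.sqrt (5 / 7) < α₁ ∧ α₁ < 1 ∧
      α₂ = Real.sqrt ((α₁ ^ 2 / 5 - 1 / 7) / (α₁ ^ 2 / 3 - 1 / 5)) := by
  have hw : 0 < a₁ - a₂ := sub_pos.2 ha21
  have hsq : 0 < α₁ ^ 2 - α₂ ^ 2 := by nlinarith
  have hden : α₁ ^ 2 / 3 - 1 / 5 = (a₁ - a₂) * α₂ ^ 2 * (α₁ ^ 2 - α₂ ^ 2) := by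
    linear_combination (-α₁ ^ 2) * e1 + e2
  have hnum : α₁ ^ 2 / 5 - 1 / 7 = α₂ ^ 2 * (α₁ ^ 2 / 3 - 1 / 5) := by
    linear_combination (-α₁ ^ 2) * e2 + e3 - α₂ ^ 2 * hden
  have hden_pos : 0 < α₁ ^ 2 / 3 - 1 / 5 := by
    rw [hden]
    positivity
  have hnum_pos : 0 < α₁ ^ 2 / 5 - 1 / 7 := by
    rw [hnum]
    positivity
  refine ⟨?_, hα1, ?_⟩
  · rw [Real.sqrt_lt' (hα2.trans hα21)]
    linarith
  · rw [hnum, mul_div_cancel_right₀ _ hden_pos.ne', Real.sqrt_sq hα2.le]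
end

section
/- Quartic case (k = 4): Suppose real numbers α₁, α₂, a₁ satisfy 0 < α₂ < α₁ < 1 and 0 < a₁ < 1, together with the two equations 1 − α₁² + a₁·(α₁² − α₂²) = 2/3 and 1 − α₁⁴ + a₁·(α₁⁴ − α₂⁴) = 4/5. Then 4/9 < a₁ < 5/6, α₁ = √( (1 + 2·√(a₁/(5·(1 − a₁))))/3 ), and α₂ = √( (1 − 2·√((1 − a₁)/(5·a₁)))/3 ). -/
/-- quartic case `k = 4`.  The two restrictions equivalent to the
4-3-order orthogonal condition force `4/9 < a₁ < 5/6` and determine `α₁, α₂` from `a₁`. -/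
theorem quartic_orth_equations (α₁ α₂ a₁ : ℝ)
    (hα2 : 0 < α₂) (hα21 : α₂ < α₁) (hα1 : α₁ < 1)
    (ha0 : 0 < a₁) (ha1 : a₁ < 1)
    (e1 : 1 - α₁ ^ 2 + a₁ * (α₁ ^ 2 - α₂ ^ 2) = 2 / 3)
    (e2 : 1 - α₁ ^ 4 + a₁ * (α₁ ^ 4 - α₂ ^ 4) = 4 / 5) :
    4 / 9 < a₁ ∧ a₁ < 5 / 6 ∧
      α₁ = Real.sqrt ((1 + 2 * Real.sqrt (a₁ / (5 * (1 - a₁)))) / 3) ∧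
      α₂ = Real.sqrt ((1 - 2 * Real.sqrt ((1 - a₁) / (5 * a₁))) / 3) := by
  have hd : 0 < α₁ ^ 2 - α₂ ^ 2 := by nlinarith
  have hb : 0 < 1 - a₁ := by linarith
  have hx : 3 * α₁ ^ 2 - 1 = 3 * a₁ * (α₁ ^ 2 - α₂ ^ 2) := by linarith
  have hy : 1 - 3 * α₂ ^ 2 = 3 * (1 - a₁) * (α₁ ^ 2 - α₂ ^ 2) := by linarith
  have hvar : a₁ * (1 - a₁) * (α₁ ^ 2 - α₂ ^ 2) ^ 2 = 4 / 45 := by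
    have hmean : (1 - a₁) * α₁ ^ 2 + a₁ * α₂ ^ 2 = 1 / 3 := by linarith
    linear_combination (-1) * e2 - ((1 - a₁) * α₁ ^ 2 + a₁ * α₂ ^ 2 + 1 / 3) * hmean
  have hu : 0 < 3 * α₁ ^ 2 - 1 := by rw [hx]; positivity
  have hv : 0 < 1 - 3 * α₂ ^ 2 := by rw [hy]; positivity
  have hu2 : (3 * α₁ ^ 2 - 1) ^ 2 * (5 * (1 - a₁)) = 4 * a₁ := by
    rw [hx]; linear_combination 45 * a₁ * hvar
  have hv2 : (1 - 3 * α₂ ^ 2) ^ 2 * (5 * a₁) = 4 * (1 - a₁) := by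
    rw [hy]; linear_combination 45 * (1 - a₁) * hvar
  have hsu : √(a₁ / (5 * (1 - a₁))) = (3 * α₁ ^ 2 - 1) / 2 := by
    rw [Real.sqrt_eq_iff_mul_self_eq (by positivity) (by positivity), div_eq_iff (by positivity)]
    linear_combination (-1 / 4) * hu2
  have hsv : √((1 - a₁) / (5 * a₁)) = (1 - 3 * α₂ ^ 2) / 2 := by
    rw [Real.sqrt_eq_iff_mul_self_eq (by positivity) (by positivity), div_eq_iff (by positivity)]
    linear_combination (-1 / 4) * hv2
  refine ⟨?_, ?_, ?_, ?_⟩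
  · have hlt : (1 - 3 * α₂ ^ 2) ^ 2 < 1 :=
      pow_lt_one₀ hv.le (by linarith [pow_pos hα2 2]) two_ne_zero
    nlinarith
  · have hlt : (3 * α₁ ^ 2 - 1) ^ 2 < 2 ^ 2 :=
      pow_lt_pow_left₀ (by nlinarith) hu.le two_ne_zero
    nlinarith
  · rw [hsu, show (1 + 2 * ((3 * α₁ ^ 2 - 1) / 2)) / 3 = α₁ ^ 2 by ring,
      Real.sqrt_sq (hα2.trans hα21).le]
  · rw [hsv, show (1 - 2 * ((1 - 3 * α₂ ^ 2) / 2)) / 3 = α₂ ^ 2 by ring, Real.sqrt_sq hα2.le]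
end

section
/- Discrete Poincaré inequality: Let k ≥ 1 and N ≥ 1 be integers, let h₁, …, h_N > 0 with Σ_{i=1}^{N} h_i = 1, and let real numbers v_{i,j} be given for i = 1, …, N and j = 0, …, k, satisfying the chaining condition v_{i,0} = v_{i−1,k} for 2 ≤ i ≤ N and the boundary conditions v_{1,0} = 0 and v_{N,k} = 0. Then there exists a constant C > 0 depending only on k (for instance C = k² suffices) such that Σ_{i=1}^{N} Σ_{j=1}^{k} h_i · v_{i,j}² ≤ C · Σ_{i=1}^{N} Σ_{j=1}^{k} h_i^{−1} · (v_{i,j} − v_{i,j−1})². -/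
/-- A finite sequence is bounded by its initial value plus its total variation. -/
lemma abs_le_abs_zero_add_sum_abs_sub (u : ℕ → ℝ) (j : ℕ) :
    |u j| ≤ |u 0| + ∑ l ∈ Finset.Icc 1 j, |u l - u (l - 1)| := by
  induction j with
  | zero => simp
  | succ j ih =>
    rw [Finset.sum_Icc_succ_top (by omega), Nat.add_sub_cancel]
    have := abs_add_le (u j) (u (j + 1) - u j)
    rw [add_sub_cancel] at this
    linarith

/-- Values of a chained family are bounded by its total variation. -/
lemma abs_le_sum_sum_abs_sub (k N : ℕ) (v : ℕ → ℕ → ℝ)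
    (hchain : ∀ i, 2 ≤ i → i ≤ N → v i 0 = v (i - 1) k) (h0 : v 1 0 = 0)
    {i j : ℕ} (hi : i ∈ Finset.Icc 1 N) (hj : j ∈ Finset.Icc 1 k) :
    |v i j| ≤ ∑ a ∈ Finset.Icc 1 N, ∑ b ∈ Finset.Icc 1 k, |v a b - v a (b - 1)| := by
  have hstart : ∀ m, m + 1 ≤ N → |v (m + 1) 0| ≤
      ∑ a ∈ Finset.Icc 1 m, ∑ b ∈ Finset.Icc 1 k, |v a b - v a (b - 1)| := by
    intro m
    induction m with
    | zero => simp [h0]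
    | succ m ih =>
      intro hm
      rw [Finset.sum_Icc_succ_top (by omega), hchain (m + 1 + 1) (by omega) hm,
        Nat.add_sub_cancel]
      have := ih (by omega)
      have := abs_le_abs_zero_add_sum_abs_sub (v (m + 1)) k
      linarith
  rw [Finset.mem_Icc] at hi hj
  obtain ⟨m, rfl⟩ : ∃ m, i = m + 1 := ⟨i - 1, by omega⟩
  calc |v (m + 1) j|
      ≤ |v (m + 1) 0| + ∑ b ∈ Finset.Icc 1 j, |v (m + 1) b - v (m + 1) (b - 1)| :=
        abs_le_abs_zero_add_sum_abs_sub _ j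
    _ ≤ (∑ a ∈ Finset.Icc 1 m, ∑ b ∈ Finset.Icc 1 k, |v a b - v a (b - 1)|) +
          ∑ b ∈ Finset.Icc 1 k, |v (m + 1) b - v (m + 1) (b - 1)| :=
        add_le_add (hstart m hi.2)
          (Finset.sum_le_sum_of_subset_of_nonneg (Finset.Icc_subset_Icc_right hj.2)
            fun _ _ _ => abs_nonneg _)
    _ = ∑ a ∈ Finset.Icc 1 (m + 1), ∑ b ∈ Finset.Icc 1 k, |v a b - v a (b - 1)| :=
        (Finset.sum_Icc_succ_top (by omega) _).symm
    _ ≤ _ := Finset.sum_le_sum_of_subset_of_nonneg (Finset.Icc_subset_Icc_right hi.2)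
        fun _ _ _ => Finset.sum_nonneg fun _ _ => abs_nonneg _

/-- Weighted Cauchy–Schwarz inequality for a double sum. -/
lemma sq_sum_sum_abs_le {s t : Finset ℕ} (h : ℕ → ℝ) (d : ℕ → ℕ → ℝ)
    (hpos : ∀ i ∈ s, 0 < h i) :
    (∑ i ∈ s, ∑ j ∈ t, |d i j|) ^ 2 ≤
      (t.card * ∑ i ∈ s, h i) * ∑ i ∈ s, ∑ j ∈ t, (h i)⁻¹ * d i j ^ 2 := by
  have hweights : t.card * ∑ i ∈ s, h i = ∑ i ∈ s, ∑ _j ∈ t, h i := by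
    simp [Finset.mul_sum]
  rw [hweights, ← Finset.sum_product', ← Finset.sum_product', ← Finset.sum_product']
  refine Finset.sum_sq_le_sum_mul_sum_of_sq_le_mul _ (fun p hp => ?_) (fun p hp => ?_)
    fun p hp => ?_
  all_goals have hp := hpos p.1 (Finset.mem_product.1 hp).1
  · exact hp.le
  · positivity
  · exact (by rw [sq_abs, mul_inv_cancel_left₀ hp.ne'] : _ = _).le


/-- discrete Poincaré inequality for piecewise constant test
functions on the dual mesh: there is `C > 0` depending only on `k` (e.g.
`C = k²`) with `‖v‖²_{0,T*} ≤ C |v|²_{1,T*}`. -/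
theorem discrete_poincare (k : ℕ) (hk : 1 ≤ k) :
    ∃ C : ℝ, 0 < C ∧
      ∀ N : ℕ, 1 ≤ N → ∀ (h : ℕ → ℝ) (v : ℕ → ℕ → ℝ),
        (∀ i, 1 ≤ i → i ≤ N → 0 < h i) →
        (∑ i ∈ Finset.Icc 1 N, h i = 1) →
        (∀ i, 2 ≤ i → i ≤ N → v i 0 = v (i - 1) k) →
        v 1 0 = 0 → v N k = 0 →
        ∑ i ∈ Finset.Icc 1 N, ∑ j ∈ Finset.Icc 1 k, h i * (v i j) ^ 2 ≤
          C * ∑ i ∈ Finset.Icc 1 N, ∑ j ∈ Finset.Icc 1 k,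
            (h i)⁻¹ * (v i j - v i (j - 1)) ^ 2 := by
  have hk' : (0 : ℝ) < k := by exact_mod_cast hk
  refine ⟨(k : ℝ) ^ 2, by positivity, ?_⟩
  intro N _ h v hpos hsum hchain h0 _
  set R := ∑ i ∈ Finset.Icc 1 N, ∑ j ∈ Finset.Icc 1 k, (h i)⁻¹ * (v i j - v i (j - 1)) ^ 2
    with hR
  have hpos' : ∀ i ∈ Finset.Icc 1 N, 0 < h i := fun i hi =>
    hpos i (Finset.mem_Icc.1 hi).1 (Finset.mem_Icc.1 hi).2
  have hvar := sq_sum_sum_abs_le (t := Finset.Icc 1 k) h (fun i j => v i j - v i (j - 1)) hpos'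
  rw [hsum, Nat.card_Icc, Nat.add_sub_cancel, mul_one, ← hR] at hvar
  calc ∑ i ∈ Finset.Icc 1 N, ∑ j ∈ Finset.Icc 1 k, h i * (v i j) ^ 2
      ≤ ∑ i ∈ Finset.Icc 1 N, ∑ _j ∈ Finset.Icc 1 k, h i * (k * R) := by
        refine Finset.sum_le_sum fun i hi => Finset.sum_le_sum fun j hj =>
          mul_le_mul_of_nonneg_left ?_ (hpos' i hi).le
        rw [← sq_abs]
        exact (pow_le_pow_left₀ (abs_nonneg _)
          (abs_le_sum_sum_abs_sub k N v hchain h0 hi hj) 2).trans hvar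
    _ = k ^ 2 * R := by
        simp only [Finset.sum_const, Nat.card_Icc, Nat.add_sub_cancel, nsmul_eq_mul]
        rw [← Finset.mul_sum, ← Finset.sum_mul, hsum]
        ring
end
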